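/- arXiv:1107.5681 — 9 statements merged into one kernel-verified Lean document; each statement's English description precedes it below -/
import Mathlib

section
/- Let f : ℝⁿ → ℝ and h : ℝⁿ → ℝᵖ be continuously differentiable, let δ > 0, let x⁰, x¹ ∈ ℝⁿ, and let x : (0, δ) → ℝⁿ satisfy lim_{ε→0⁺} x(ε) = x⁰ and lim_{ε→0⁺} (x(ε) − x⁰)/ε = x¹. Suppose that for every ε ∈ (0, δ): ∇f(x(ε)) + (1/ε) ∑_{j=1}^{p} h_j(x(ε)) ∇h_j(x(ε)) = 0, and that the gradients ∇h₁(x⁰), …, ∇h_p(x⁰) are linearly independent. Define π*_j = ⟨∇h_j(x⁰), x¹⟩ for j = 1, …, p. Then: h(x⁰) = 0; π*_j = lim_{ε→0⁺} h_j(x(ε))/ε for each j; and ∇f(x⁰) + ∑_{j=1}^{p} π*_j ∇h_j(x⁰) = 0. In other words, (x⁰, π*) is a Karush–Kuhn–Tucker point of the problem min f(x) subject to h(x) = 0. -/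
open Filter Set RealInnerProductSpace

/-- The gradient of a `C¹` function is continuous. -/
theorem ContDiff.continuous_gradient_of_one {E : Type*} [NormedAddCommGroup E]
    [InnerProductSpace ℝ E] [CompleteSpace E] {g : E → ℝ} (hg : ContDiff ℝ 1 g) :
    Continuous (gradient g) :=
  (InnerProductSpace.toDual ℝ E).symm.continuous.comp (hg.continuous_fderiv one_ne_zero)

/-- Exact-penalty theorem (equality constraints), asymptotic form: if `x(ε)` are
stationary points of `f + (1/(2ε))‖h‖²` with `x(ε) → x0` and `(x(ε)-x0)/ε → x1`
as `ε → 0⁺`, and LICQ holds at `x0`, then with `π*_j = ⟨∇h_j(x0), x1⟩` the pair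
`(x0, π*)` is a KKT point: `h(x0) = 0`, `π*_j = lim h_j(x(ε))/ε`, and
`∇f(x0) + ∑_j π*_j ∇h_j(x0) = 0`. -/
theorem penalty_equality_kkt {n p : ℕ}
    (f : EuclideanSpace ℝ (Fin n) → ℝ)
    (h : Fin p → EuclideanSpace ℝ (Fin n) → ℝ)
    (hf : ContDiff ℝ 1 f) (hh : ∀ j, ContDiff ℝ 1 (h j))
    (δ : ℝ) (hδ : 0 < δ)
    (x0 x1 : EuclideanSpace ℝ (Fin n))
    (x : ℝ → EuclideanSpace ℝ (Fin n))
    (hlim : Tendsto x (nhdsWithin 0 (Set.Ioi 0)) (nhds x0))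
    (hlim1 : Tendsto (fun ε => (1 / ε) • (x ε - x0))
      (nhdsWithin 0 (Set.Ioi 0)) (nhds x1))
    (hstat : ∀ ε ∈ Set.Ioo (0 : ℝ) δ,
      gradient f (x ε) +
        (1 / ε) • ∑ j, (h j (x ε)) • gradient (h j) (x ε) = 0)
    (hLICQ : LinearIndependent ℝ (fun j : Fin p => gradient (h j) x0)) :
    (∀ j, h j x0 = 0) ∧
    (∀ j, Tendsto (fun ε => h j (x ε) / ε) (nhdsWithin 0 (Set.Ioi 0))
      (nhds ⟪gradient (h j) x0, x1⟫)) ∧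
    gradient f x0 + ∑ j, ⟪gradient (h j) x0, x1⟫ • gradient (h j) x0 = 0 := by
  have hmem : ∀ᶠ ε in nhdsWithin (0 : ℝ) (Ioi 0), ε ∈ Ioo (0 : ℝ) δ :=
    Ioo_mem_nhdsGT hδ
  have hgrad (j : Fin p) : Tendsto (fun ε => gradient (h j) (x ε))
      (nhdsWithin 0 (Ioi 0)) (nhds (gradient (h j) x0)) :=
    ((hh j).continuous_gradient_of_one.tendsto x0).comp hlim
  have hgradf : Tendsto (fun ε => gradient f (x ε))
      (nhdsWithin 0 (Ioi 0)) (nhds (gradient f x0)) :=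
    (hf.continuous_gradient_of_one.tendsto x0).comp hlim
  have hfeas : ∀ j, h j x0 = 0 := by
    have hid : Tendsto (fun ε : ℝ => ε) (nhdsWithin 0 (Ioi 0)) (nhds 0) :=
      tendsto_id.mono_left nhdsWithin_le_nhds
    have hscaled := (hid.smul hgradf).add (tendsto_finsetSum Finset.univ fun j _ =>
      (((hh j).continuous.tendsto x0).comp hlim).smul (hgrad j))
    have hzero := tendsto_nhds_unique_of_eventuallyEq hscaled tendsto_const_nhds (b := 0) (by
      filter_upwards [hmem] with ε hε
      have key := congrArg (ε • ·) (hstat ε hε)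
      simpa [smul_add, smul_smul, hε.1.ne'] using key)
    rw [zero_smul, zero_add] at hzero
    exact Fintype.linearIndependent_iff.mp hLICQ _ hzero
  have hmult (j : Fin p) : Tendsto (fun ε => h j (x ε) / ε) (nhdsWithin 0 (Ioi 0))
      (nhds ⟪gradient (h j) x0, x1⟫) := by
    have hd := (((hh j).differentiable one_ne_zero) x0).hasGradientAt.hasFDerivAt
    have hdiff : Tendsto (fun ε => x ε - x0) (nhdsWithin 0 (Ioi 0)) (nhds 0) := by
      simpa using hlim.sub_const x0
    have hq := hd.hasFDerivWithinAt.lim (s := univ) hdiff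
      (Eventually.of_forall fun _ => mem_univ _) hlim1
    simpa [hfeas j, div_eq_inv_mul] using hq
  refine ⟨hfeas, hmult, ?_⟩
  refine tendsto_nhds_unique_of_eventuallyEq
    (hgradf.add (tendsto_finsetSum Finset.univ fun j _ => (hmult j).smul (hgrad j)))
    tendsto_const_nhds ?_
  filter_upwards [hmem] with ε hε
  simpa only [Finset.smul_sum, smul_smul, one_div, div_eq_inv_mul, mul_one] using hstat ε hε
end

section
/- Let f : ℝⁿ → ℝ, g : ℝⁿ → ℝᵐ and h : ℝⁿ → ℝᵖ be continuously differentiable, let δ > 0, let x⁰, x¹ ∈ ℝⁿ, and let x : (0, δ) → ℝⁿ satisfy lim_{ε→0⁺} x(ε) = x⁰ and lim_{ε→0⁺} (x(ε) − x⁰)/ε = x¹. Suppose that for every ε ∈ (0, δ): ∇f(x(ε)) + (1/ε) ∑_{i=1}^{m} max{0, g_i(x(ε))} ∇g_i(x(ε)) + (1/ε) ∑_{j=1}^{p} h_j(x(ε)) ∇h_j(x(ε)) = 0, and suppose that the set of vectors {∇g_i(x⁰) : i with g_i(x⁰) ≥ 0} ∪ {∇h_j(x⁰) : j = 1, …, p}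 is linearly independent. Define μ*_i = 0 if g_i(x⁰) < 0 and μ*_i = max{0, ⟨∇g_i(x⁰), x¹⟩} if g_i(x⁰) = 0, and define π*_j = ⟨∇h_j(x⁰), x¹⟩. Then (x⁰, μ*, π*) is a Karush–Kuhn–Tucker point of the problem min f(x) subject to g(x) ≤ 0, h(x) = 0: g(x⁰) ≤ 0, h(x⁰) = 0, μ* ≥ 0, μ*_i g_i(x⁰) = 0 for all i, and ∇f(x⁰) + ∑_{i=1}^{m} μ*_i ∇g_i(x⁰) + ∑_{j=1}^{p} π*_j ∇h_j(x⁰) = 0. -/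
open Filter Set RealInnerProductSpace

/-- A continuously differentiable function has a continuous gradient. -/
theorem ContDiff.continuous_gradient {E : Type*} [NormedAddCommGroup E] [InnerProductSpace ℝ E]
    [CompleteSpace E] {F : E → ℝ} (hF : ContDiff ℝ 1 F) : Continuous (gradient F) :=
  (InnerProductSpace.toDual ℝ E).symm.continuous.comp (hF.continuous_fderiv one_ne_zero)

/-- If `x → x0` and the rescaled increments `c • (x - x0)` converge to `x1`, then at a zero `x0` of
`F` the rescaled values `c * F x` converge to the derivative of `F` in the direction `x1`. -/
theorem DifferentiableAt.tendsto_mul_inner_gradient {E α : Type*} [NormedAddCommGroup E]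
    [InnerProductSpace ℝ E] [CompleteSpace E] {F : E → ℝ} {x0 x1 : E} {l : Filter α} {c : α → ℝ}
    {x : α → E} (hF : DifferentiableAt ℝ F x0) (h0 : F x0 = 0) (hx : Tendsto x l (nhds x0))
    (hcx : Tendsto (fun a => c a • (x a - x0)) l (nhds x1)) :
    Tendsto (fun a => c a * F (x a)) l (nhds ⟪gradient F x0, x1⟫) := by
  have key := hF.hasGradientAt.hasFDerivAt.hasFDerivWithinAt (s := Set.univ) |>.lim
    (tendsto_sub_nhds_zero_iff.2 hx) (Eventually.of_forall fun _ => Set.mem_univ _) hcx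
  simpa [h0] using key

/-- Exact-penalty theorem (general constraints), asymptotic form: if `x(ε)` are
stationary points of `f + (1/(2ε))‖max{0,g}‖² + (1/(2ε))‖h‖²` with `x(ε) → x0`
and `(x(ε)-x0)/ε → x1` as `ε → 0⁺`, and the Modified LICQ holds at `x0`, then
with `μ*_i = 0` when `g_i(x0) < 0`, `μ*_i = max{0, ⟨∇g_i(x0), x1⟩}` when
`g_i(x0) = 0`, and `π*_j = ⟨∇h_j(x0), x1⟩`, the triplet `(x0, μ*, π*)` is a
KKT point. -/
theorem penalty_general_kkt {n m p : ℕ}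
    (f : EuclideanSpace ℝ (Fin n) → ℝ)
    (g : Fin m → EuclideanSpace ℝ (Fin n) → ℝ)
    (h : Fin p → EuclideanSpace ℝ (Fin n) → ℝ)
    (hf : ContDiff ℝ 1 f) (hg : ∀ i, ContDiff ℝ 1 (g i))
    (hh : ∀ j, ContDiff ℝ 1 (h j))
    (δ : ℝ) (hδ : 0 < δ)
    (x0 x1 : EuclideanSpace ℝ (Fin n))
    (x : ℝ → EuclideanSpace ℝ (Fin n))
    (hlim : Tendsto x (nhdsWithin 0 (Set.Ioi 0)) (nhds x0))
    (hlim1 : Tendsto (fun ε => (1 / ε) • (x ε - x0))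
      (nhdsWithin 0 (Set.Ioi 0)) (nhds x1))
    (hstat : ∀ ε ∈ Set.Ioo (0 : ℝ) δ,
      gradient f (x ε) +
        (1 / ε) • ∑ i, (max 0 (g i (x ε))) • gradient (g i) (x ε) +
        (1 / ε) • ∑ j, (h j (x ε)) • gradient (h j) (x ε) = 0)
    (hMLICQ : LinearIndependent ℝ
      (Sum.elim (fun i : {i : Fin m // 0 ≤ g i x0} => gradient (g i.1) x0)
        (fun j : Fin p => gradient (h j) x0)))
    (μ : Fin m → ℝ)
    (hμ : ∀ i, μ i = if g i x0 < 0 then 0 else max 0 ⟪gradient (g i) x0, x1⟫)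
    (π : Fin p → ℝ)
    (hπ : ∀ j, π j = ⟪gradient (h j) x0, x1⟫) :
    (∀ i, g i x0 ≤ 0) ∧ (∀ j, h j x0 = 0) ∧
    (∀ i, 0 ≤ μ i) ∧ (∀ i, μ i * g i x0 = 0) ∧
    gradient f x0 + ∑ i, μ i • gradient (g i) x0 +
      ∑ j, π j • gradient (h j) x0 = 0 := by
  have hpos : ∀ᶠ ε in nhdsWithin (0 : ℝ) (Set.Ioi 0), ε ∈ Set.Ioo (0 : ℝ) δ :=
    Ioo_mem_nhdsGT hδ
  have hid : Tendsto (fun ε : ℝ => ε) (nhdsWithin 0 (Set.Ioi 0)) (nhds 0) :=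
    tendsto_nhdsWithin_of_tendsto_nhds tendsto_id
  have hGf : Tendsto (fun ε => gradient f (x ε)) (nhdsWithin 0 (Set.Ioi 0))
      (nhds (gradient f x0)) := (hf.continuous_gradient.tendsto x0).comp hlim
  have hGg : ∀ i, Tendsto (fun ε => gradient (g i) (x ε)) (nhdsWithin 0 (Set.Ioi 0))
      (nhds (gradient (g i) x0)) := fun i => ((hg i).continuous_gradient.tendsto x0).comp hlim
  have hGh : ∀ j, Tendsto (fun ε => gradient (h j) (x ε)) (nhdsWithin 0 (Set.Ioi 0))
      (nhds (gradient (h j) x0)) := fun j => ((hh j).continuous_gradient.tendsto x0).comp hlim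
  have hgl : ∀ i, Tendsto (fun ε => g i (x ε)) (nhdsWithin 0 (Set.Ioi 0)) (nhds (g i x0)) :=
    fun i => ((hg i).continuous.tendsto x0).comp hlim
  have hhl : ∀ j, Tendsto (fun ε => h j (x ε)) (nhdsWithin 0 (Set.Ioi 0)) (nhds (h j x0)) :=
    fun j => ((hh j).continuous.tendsto x0).comp hlim
  have hcomb : ∑ i, max 0 (g i x0) • gradient (g i) x0 + ∑ j, h j x0 • gradient (h j) x0 = 0 := by
    have hl : Tendsto (fun ε => ε • gradient f (x ε) +
        (∑ i, max 0 (g i (x ε)) • gradient (g i) (x ε) + ∑ j, h j (x ε) • gradient (h j) (x ε)))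
        (nhdsWithin 0 (Set.Ioi 0)) (nhds ((0 : ℝ) • gradient f x0 +
          (∑ i, max 0 (g i x0) • gradient (g i) x0 + ∑ j, h j x0 • gradient (h j) x0))) :=
      (hid.smul hGf).add
        ((tendsto_finsetSum _ fun i _ => (tendsto_const_nhds.max (hgl i)).smul (hGg i)).add
          (tendsto_finsetSum _ fun j _ => (hhl j).smul (hGh j)))
    have hz : Tendsto (fun _ : ℝ => (0 : EuclideanSpace ℝ (Fin n)))
        (nhdsWithin 0 (Set.Ioi 0)) (nhds 0) := tendsto_const_nhds
    have heq := tendsto_nhds_unique (hl.congr' ?_) hz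
    · simpa using heq
    · filter_upwards [hpos] with ε hε
      have hs := congrArg (fun v => ε • v) (hstat ε hε)
      simpa [smul_add, smul_inv_smul₀ hε.1.ne', add_assoc] using hs
  have hsub : ∑ i : {i : Fin m // 0 ≤ g i x0}, g i.1 x0 • gradient (g i.1) x0 =
      ∑ i, max 0 (g i x0) • gradient (g i) x0 := by
    rw [← Fintype.sum_subtype_add_sum_subtype (fun i => 0 ≤ g i x0)
      fun i => max 0 (g i x0) • gradient (g i) x0,
      Fintype.sum_eq_zero (fun i : {i : Fin m // ¬0 ≤ g i x0} => _) fun i => by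
        rw [max_eq_left (not_le.1 i.2).le, zero_smul], add_zero]
    exact Finset.sum_congr rfl fun i _ => by rw [max_eq_right i.2]
  have hcoef := Fintype.linearIndependent_iff.1 hMLICQ
    (Sum.elim (fun i => g i.1 x0) (fun j => h j x0))
    (by simpa [Fintype.sum_sum_type, hsub] using hcomb)
  have hg0 : ∀ i, g i x0 ≤ 0 := fun i => by
    by_contra! hi
    exact hi.ne' (hcoef (Sum.inl ⟨i, hi.le⟩))
  have hh0 : ∀ j, h j x0 = 0 := fun j => hcoef (Sum.inr j)
  have hμl : ∀ i, Tendsto (fun ε => (1 / ε) * max 0 (g i (x ε))) (nhdsWithin 0 (Set.Ioi 0))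
      (nhds (μ i)) := by
    intro i
    rw [hμ i]
    split_ifs with hi
    · refine tendsto_const_nhds.congr' ?_
      filter_upwards [(hgl i).eventually_lt_const hi] with ε hε
      rw [max_eq_left hε.le, mul_zero]
    · have hl := ((hg i).differentiable one_ne_zero x0).tendsto_mul_inner_gradient
        (le_antisymm (hg0 i) (not_lt.1 hi)) hlim hlim1
      refine ((tendsto_const_nhds (x := (0 : ℝ))).max hl).congr' ?_
      filter_upwards [hpos] with ε hε
      rw [mul_max_of_nonneg _ _ (one_div_pos.2 hε.1).le, mul_zero]
  have hπl : ∀ j, Tendsto (fun ε => (1 / ε) * h j (x ε)) (nhdsWithin 0 (Set.Ioi 0))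
      (nhds (π j)) := fun j => hπ j ▸
    ((hh j).differentiable one_ne_zero x0).tendsto_mul_inner_gradient (hh0 j) hlim hlim1
  refine ⟨hg0, hh0, fun i => ?_, fun i => ?_, ?_⟩
  · rw [hμ i]
    split_ifs
    · exact le_rfl
    · exact le_max_left _ _
  · rcases (hg0 i).lt_or_eq with hi | hi
    · rw [hμ i, if_pos hi, zero_mul]
    · rw [hi, mul_zero]
  · have hl := (hGf.add (tendsto_finsetSum Finset.univ fun i _ => (hμl i).smul (hGg i))).add
      (tendsto_finsetSum Finset.univ fun j _ => (hπl j).smul (hGh j))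
    refine tendsto_nhds_unique (hl.congr' ?_) tendsto_const_nhds
    filter_upwards [hpos] with ε hε
    simpa only [Finset.smul_sum, smul_smul] using hstat ε hε
end

section
/- Let f : ℝⁿ → ℝ, g : ℝⁿ → ℝᵐ and h : ℝⁿ → ℝᵖ be continuously differentiable, and let x* be a local minimum of the problem min f(x) subject to g(x) ≤ 0 (componentwise) and h(x) = 0. Assume the LICQ condition holds at x*: the set of gradients of the active constraints at x*, namely {∇g_i(x*) : i with g_i(x*) = 0} ∪ {∇h_j(x*) : j = 1, …, p}, is linearly independent. Then there exist vectors μ* ∈ ℝᵐ and π* ∈ ℝᵖ such that μ* ≥ 0, μ*_i g_i(x*) = 0 for all i = 1, …, m, and ∇f(x*) + ∑_{i=1}^{m} μ*_i ∇g_i(x*) + ∑_{j=1}^{p} π*_j ∇h_j(x*) = 0, i.e. (x*, μ*, π*) is a Karush–Kuhn–Tucker point. -/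
open Filter Set

/-- A map into a finite-dimensional space whose strict derivative is onto can be lifted along lines:
for each direction `v` there is a differentiable curve through `a` along which `F` moves
affinely with velocity `v`. -/
theorem HasStrictFDerivAt.exists_curve_of_surjective
    {E G : Type*} [NormedAddCommGroup E] [NormedSpace ℝ E]
    [NormedAddCommGroup G] [NormedSpace ℝ G] [FiniteDimensional ℝ G]
    {F : E → G} {F' : E →L[ℝ] G} {a : E} (hF : HasStrictFDerivAt F F' a)
    (hsurj : Function.Surjective F') (v : G) :
    ∃ (γ : ℝ → E) (w : E), γ 0 = a ∧ HasDerivAt γ w 0 ∧ F' w = v ∧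
      ∀ᶠ t in nhds (0 : ℝ), F (γ t) = F a + t • v := by
  have : CompleteSpace G := FiniteDimensional.complete ℝ G
  obtain ⟨B, hB⟩ :=
    F'.exists_rightInverse_of_surjective (LinearMap.range_eq_top.2 hsurj)
  have hFB : HasStrictFDerivAt (fun y => F (a + B y))
      ((ContinuousLinearEquiv.refl ℝ G : G ≃L[ℝ] G) : G →L[ℝ] G) 0 := by
    have h₁ : HasStrictFDerivAt (fun y => a + B y) B 0 := B.hasStrictFDerivAt.const_add a
    have h₂ : HasStrictFDerivAt F F' (a + B 0) := by simpa using hF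
    have h₃ := h₂.comp (0 : G) h₁
    rw [hB] at h₃
    exact h₃
  set ψ := hFB.localInverse _ _ _
  have hψ0 : ψ (F a) = 0 := by
    have := hFB.localInverse_apply_image
    simpa using this
  have hψ' : HasStrictFDerivAt ψ (ContinuousLinearMap.id ℝ G) (F a) := by
    have := hFB.to_localInverse
    simpa using this
  have hψr : ∀ᶠ y in nhds (F a), F (a + B (ψ y)) = y := by
    have := hFB.eventually_right_inverse
    simpa using this
  have hline : HasDerivAt (fun t : ℝ => F a + t • v) v 0 := by
    simpa using ((hasDerivAt_id (0 : ℝ)).smul_const v).const_add (F a)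
  have htend : Tendsto (fun t : ℝ => F a + t • v) (nhds 0) (nhds (F a)) := by
    simpa using hline.continuousAt.tendsto
  refine ⟨fun t => a + B (ψ (F a + t • v)), B v, ?_, ?_, ?_, htend.eventually hψr⟩
  · simp [hψ0]
  · have h₁ : HasFDerivAt ψ (ContinuousLinearMap.id ℝ G) (F a + (0 : ℝ) • v) := by
      simpa using hψ'.hasFDerivAt
    have h₂ := h₁.comp_hasDerivAt (0 : ℝ) hline
    exact (B.hasFDerivAt.comp_hasDerivAt (0 : ℝ) h₂).const_add a
  · exact DFunLike.congr_fun hB v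

/-- A finite family of linearly independent continuous functionals is jointly surjective. -/
theorem LinearIndependent.surjective_continuousLinearMap_pi
    {E ι : Type*} [NormedAddCommGroup E] [NormedSpace ℝ E] [Fintype ι]
    {c : ι → StrongDual ℝ E} (hc : LinearIndependent ℝ c) :
    Function.Surjective (ContinuousLinearMap.pi c) := by
  classical
  rw [← ContinuousLinearMap.coe_coe, ← LinearMap.range_eq_top]
  by_contra hne
  obtain ⟨Λ, hΛ, hle⟩ := Submodule.exists_le_ker_of_lt_top _ (lt_top_iff_ne_top.2 hne)
  have hsum (y : ι → ℝ) : Λ y = ∑ k, Λ (Pi.single k 1) * y k := by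
    conv_lhs => rw [pi_eq_sum_univ' y]
    simp [mul_comm]
  refine hΛ (LinearMap.ext fun y => ?_)
  have hzero : ∀ k, Λ (Pi.single k 1) = 0 := by
    refine Fintype.linearIndependent_iff.1 hc _ ?_
    ext x
    have hx := LinearMap.congr_fun (LinearMap.range_le_ker_iff.1 hle) x
    have hx' := (hsum _).symm.trans hx
    simpa using hx'
  rw [hsum]
  simp [hzero]

/-- Multiplier rule with all constraints active: at a local minimum of `φ` subject to `c k ≤ 0` for
`k ∈ I` and `c k = 0` for `k ∉ I`, if the derivatives of all the `c k` are linearly independent,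
then there are Lagrange multipliers, nonnegative on `I`. -/
theorem IsLocalMinOn.exists_nonneg_multipliers
    {E ι : Type*} [NormedAddCommGroup E] [NormedSpace ℝ E] [CompleteSpace E] [Fintype ι]
    {φ : E → ℝ} {φ' : StrongDual ℝ E} {c : ι → E → ℝ} {c' : ι → StrongDual ℝ E} {I : Set ι}
    {a : E}
    (hmin : IsLocalMinOn φ {x | ∀ k, (k ∈ I → c k x ≤ 0) ∧ (k ∉ I → c k x = 0)} a)
    (ha : ∀ k, c k a = 0) (hφ : HasStrictFDerivAt φ φ' a)
    (hc : ∀ k, HasStrictFDerivAt (c k) (c' k) a) (hli : LinearIndependent ℝ c') :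
    ∃ Λ : ι → ℝ, (∀ k ∈ I, 0 ≤ Λ k) ∧ φ' + ∑ k, Λ k • c' k = 0 := by
  classical
  have hextr : IsLocalExtrOn φ {x | ∀ k, c k x = c k a} a := by
    refine Or.inl (hmin.on_subset fun x hx k => ?_)
    have hk : c k x = 0 := (hx k).trans (ha k)
    exact ⟨fun _ => hk.le, fun _ => hk⟩
  obtain ⟨M, M₀, hM, hsum⟩ := hextr.exists_multipliers_of_hasStrictFDerivAt hc hφ
  have hM₀ : M₀ ≠ 0 := by
    rintro rfl
    refine hM (Prod.ext (funext ?_) rfl)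
    exact Fintype.linearIndependent_iff.1 hli M (by simpa using hsum)
  have hstat : φ' + ∑ k, (M k / M₀) • c' k = 0 := by
    have hscaled := congrArg (fun L => M₀⁻¹ • L) hsum
    simp only [smul_add, Finset.smul_sum, smul_smul, inv_mul_cancel₀ hM₀, one_smul,
      smul_zero] at hscaled
    simpa only [div_eq_inv_mul, add_comm] using hscaled
  refine ⟨fun k => M k / M₀, fun k hk => ?_, hstat⟩
  obtain ⟨γ, w, hγ0, hγ', hw, hγ⟩ :=
    (hasStrictFDerivAt_pi.2 hc).exists_curve_of_surjective
      hli.surjective_continuousLinearMap_pi (-Pi.single k 1)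
  have hw' (l : ι) : c' l w = -(Pi.single k 1 : ι → ℝ) l := congrFun hw l
  have hderiv : φ' w = M k / M₀ := by
    have hz := DFunLike.congr_fun hstat w
    simp [hw', Pi.single_apply] at hz
    linarith
  have hφγ : HasDerivAt (φ ∘ γ) (φ' w) 0 := by
    have h₁ : HasFDerivAt φ φ' (γ 0) := by simpa [hγ0] using hφ.hasFDerivAt
    exact h₁.comp_hasDerivAt (0 : ℝ) hγ'
  have hmin₀ : IsLocalMinOn (φ ∘ γ) (Ici 0) 0 := by
    have hlim : Tendsto γ (nhds 0) (nhds a) := by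
      simpa [hγ0] using hγ'.continuousAt.tendsto
    have hev := hlim.eventually (eventually_nhdsWithin_iff.1 hmin)
    refine eventually_nhdsWithin_iff.2 ?_
    filter_upwards [hev, hγ] with t ht htγ ht0
    simp only [Function.comp_apply, hγ0]
    refine ht fun l => ?_
    have hcl : c l (γ t) = -(t * (Pi.single k 1 : ι → ℝ) l) := by
      simpa [ha] using congrFun htγ l
    rw [hcl]
    refine ⟨fun _ => ?_, fun hl => ?_⟩
    · rw [neg_nonpos]
      refine mul_nonneg ht0 ?_
      by_cases hlk : l = k <;> simp [hlk]
    · have hlk : l ≠ k := fun h => hl (h ▸ hk)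
      simp [hlk]
  have hone : (1 : ℝ) ∈ posTangentConeAt (Ici (0 : ℝ)) 0 := by
    refine mem_posTangentConeAt_of_segment_subset ?_
    rw [zero_add, segment_eq_Icc zero_le_one]
    exact Icc_subset_Ici_self
  have hnonneg := hmin₀.hasFDerivWithinAt_nonneg hφγ.hasFDerivAt.hasFDerivWithinAt hone
  simpa [hderiv] using hnonneg

/-- First-order necessary optimality conditions (KKT theorem): a local minimum
of `min f` s.t. `g ≤ 0`, `h = 0`, at which the LICQ holds (the gradients of the
active constraints are linearly independent), admits KKT multipliers. -/
theorem kkt_necessary_conditions {n m p : ℕ}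
    (f : EuclideanSpace ℝ (Fin n) → ℝ)
    (g : Fin m → EuclideanSpace ℝ (Fin n) → ℝ)
    (h : Fin p → EuclideanSpace ℝ (Fin n) → ℝ)
    (hf : ContDiff ℝ 1 f) (hg : ∀ i, ContDiff ℝ 1 (g i))
    (hh : ∀ j, ContDiff ℝ 1 (h j))
    (xstar : EuclideanSpace ℝ (Fin n))
    (hfeas_g : ∀ i, g i xstar ≤ 0) (hfeas_h : ∀ j, h j xstar = 0)
    (hlocmin : ∃ U ∈ nhds xstar, ∀ x ∈ U,
      (∀ i, g i x ≤ 0) → (∀ j, h j x = 0) → f xstar ≤ f x)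
    (hLICQ : LinearIndependent ℝ
      (Sum.elim (fun i : {i : Fin m // g i xstar = 0} => gradient (g i.1) xstar)
        (fun j : Fin p => gradient (h j) xstar))) :
    ∃ (μ : Fin m → ℝ) (π : Fin p → ℝ),
      (∀ i, 0 ≤ μ i) ∧ (∀ i, μ i * g i xstar = 0) ∧
      gradient f xstar + ∑ i, μ i • gradient (g i) xstar +
        ∑ j, π j • gradient (h j) xstar = 0 := by
  classical
  let c : {i : Fin m // g i xstar = 0} ⊕ Fin p → EuclideanSpace ℝ (Fin n) → ℝ :=
    Sum.elim (fun i => g i.1) h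
  have hc (k) : HasStrictFDerivAt (c k) (InnerProductSpace.toDual ℝ _ (gradient (c k) xstar))
      xstar := by
    rw [toDual_gradient]
    rcases k with i | j
    · exact (hg i.1).hasStrictFDerivAt one_ne_zero
    · exact (hh j).hasStrictFDerivAt one_ne_zero
  have hf' : HasStrictFDerivAt f (InnerProductSpace.toDual ℝ _ (gradient f xstar)) xstar := by
    rw [toDual_gradient]
    exact hf.hasStrictFDerivAt one_ne_zero
  have hgrad : (Sum.elim (fun i : {i : Fin m // g i xstar = 0} => gradient (g i.1) xstar)
      (fun j : Fin p => gradient (h j) xstar)) = fun k => gradient (c k) xstar := by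
    ext1 k
    rcases k with i | j <;> rfl
  rw [hgrad] at hLICQ
  have hli : LinearIndependent ℝ
      (fun k => InnerProductSpace.toDual ℝ _ (gradient (c k) xstar)) := by
    rw [Fintype.linearIndependent_iff] at hLICQ ⊢
    intro b hb
    refine hLICQ b ((InnerProductSpace.toDual ℝ (EuclideanSpace ℝ (Fin n))).injective ?_)
    simpa [map_sum] using hb
  have hca (k) : c k xstar = 0 := by
    rcases k with i | j
    · exact i.2
    · exact hfeas_h j
  have hmin : IsLocalMinOn f
      {x | ∀ k, (k ∈ range Sum.inl → c k x ≤ 0) ∧ (k ∉ range Sum.inl → c k x = 0)} xstar := by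
    obtain ⟨U, hU, hUmin⟩ := hlocmin
    have hinactive : ∀ᶠ x in nhds xstar, ∀ i, g i xstar ≠ 0 → g i x ≤ 0 := by
      refine eventually_all.2 fun i => ?_
      by_cases hi : g i xstar = 0
      · exact Eventually.of_forall fun _ hne => absurd hi hne
      · filter_upwards [(hg i).continuous.continuousAt.eventually_lt_const
          (lt_of_le_of_ne (hfeas_g i) hi)] with x hx _ using hx.le
    refine eventually_nhdsWithin_iff.2 ?_
    filter_upwards [hU, hinactive] with x hxU hx hxc
    refine hUmin x hxU (fun i => ?_) (fun j => (hxc (Sum.inr j)).2 (by simp))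
    by_cases hi : g i xstar = 0
    · exact (hxc (Sum.inl ⟨i, hi⟩)).1 (mem_range_self _)
    · exact hx i hi
  obtain ⟨Λ, hΛ, hstat⟩ := hmin.exists_nonneg_multipliers hca hf' hc hli
  refine ⟨fun i => if hi : g i xstar = 0 then Λ (Sum.inl ⟨i, hi⟩) else 0,
    fun j => Λ (Sum.inr j), fun i => ?_, fun i => ?_, ?_⟩
  · dsimp only
    split_ifs with hi
    · exact hΛ _ (mem_range_self _)
    · exact le_rfl
  · by_cases hi : g i xstar = 0 <;> simp [hi]
  · have hsum : ∑ i, (if hi : g i xstar = 0 then Λ (Sum.inl ⟨i, hi⟩) else 0) •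
        gradient (g i) xstar =
        ∑ i : {i : Fin m // g i xstar = 0}, Λ (Sum.inl i) • gradient (g i.1) xstar := by
      rw [← Fintype.sum_subtype_add_sum_subtype (fun i => g i xstar = 0)]
      have hzero : ∑ i : {i : Fin m // ¬ g i xstar = 0},
          (if hi : g i.1 xstar = 0 then Λ (Sum.inl ⟨i.1, hi⟩) else 0) •
            gradient (g i.1) xstar = 0 :=
        Finset.sum_eq_zero fun i _ => by rw [dif_neg i.2, zero_smul]
      rw [hzero, add_zero]
      exact Finset.sum_congr rfl fun i _ => by rw [dif_pos i.2]
    rw [hsum, add_assoc]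
    refine (InnerProductSpace.toDual ℝ (EuclideanSpace ℝ (Fin n))).injective ?_
    simpa [map_sum, Fintype.sum_sum_type, c] using hstat
end

section
/- Let f : ℝⁿ → ℝ and φ : ℝⁿ → ℝ be functions with φ(x) ≥ 0 for all x, and let P(x, ε) = f(x) + φ(x)/(2ε). Let (ε_k) be a strictly decreasing sequence of positive real numbers converging to 0, and for each k let x^k be a global minimizer of P(·, ε_k) over ℝⁿ. Then the sequence f(x^k) is monotonically non-decreasing in k, i.e. f(x^k) ≤ f(x^{k+1}) for all k. -/
open Filter

/-- Lowering the penalty parameter from `a` to `b` cannot decrease the objective value of a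
minimizer: only the comparison of the two minimizers `x` and `y` with each other matters. -/
theorem objective_le_of_penalty_le {α : Type*} {f φ : α → ℝ} {a b : ℝ} {x y : α}
    (hb : 0 < b) (hba : b < a)
    (hx : f x + φ x / (2 * a) ≤ f y + φ y / (2 * a))
    (hy : f y + φ y / (2 * b) ≤ f x + φ x / (2 * b)) : f x ≤ f y := by
  have ha : 0 < a := hb.trans hba
  have hxa : f x * (2 * a) + φ x ≤ f y * (2 * a) + φ y := by
    rwa [add_div' _ _ _ (by positivity), add_div' _ _ _ (by positivity),
      div_le_div_iff_of_pos_right (by positivity)] at hx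
  have hyb : f y * (2 * b) + φ y ≤ f x * (2 * b) + φ x := by
    rwa [add_div' _ _ _ (by positivity), add_div' _ _ _ (by positivity),
      div_le_div_iff_of_pos_right (by positivity)] at hy
  nlinarith

/-- Part (iii) of the sequential penalty method convergence theorem: the
objective values `f(x^k)` are monotonically non-decreasing along a decreasing
sequence of penalty parameters. -/
theorem penalty_objective_monotone {n : ℕ}
    (f φ : EuclideanSpace ℝ (Fin n) → ℝ)
    (hφ : ∀ x, 0 ≤ φ x)
    (P : EuclideanSpace ℝ (Fin n) → ℝ → ℝ)
    (hP : ∀ x ε, P x ε = f x + φ x / (2 * ε))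
    (ε : ℕ → ℝ) (hεpos : ∀ k, 0 < ε k) (hεanti : StrictAnti ε)
    (hεlim : Tendsto ε atTop (nhds 0))
    (xk : ℕ → EuclideanSpace ℝ (Fin n))
    (hmin : ∀ k, ∀ x, P (xk k) (ε k) ≤ P x (ε k)) :
    ∀ k, f (xk k) ≤ f (xk (k + 1)) := by
  intro k
  exact objective_le_of_penalty_le (hεpos (k + 1)) (hεanti k.lt_succ_self)
    (by simpa only [hP] using hmin k (xk (k + 1)))
    (by simpa only [hP] using hmin (k + 1) (xk k))
end

section
/- Let f : ℝⁿ → ℝ and φ : ℝⁿ → ℝ be functions with φ(x) ≥ 0 for all x, let X = {x ∈ ℝⁿ : φ(x) = 0} be nonempty, and assume f is bounded below on X. Let P(x, ε) = f(x) + φ(x)/(2ε), let (ε_k) be a strictly decreasing sequence of positive real numbers converging to 0, and for each k let x^k be a global minimizer of P(·, ε_k) over ℝⁿ. Then lim_{k→∞} φ(x^k) = 0. -/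
open Filter

/-- Comparing a penalty minimizer `y` for the parameter `b` with a feasible point `z`, and a
minimizer `x` for a larger parameter `a` with `y`, bounds the constraint violation at `y`. -/
theorem violation_le_of_penalty_minimizers {α : Type*} {f φ : α → ℝ} {a b : ℝ} {x y z : α}
    (hb : 0 < b) (hba : b < a) (hz : φ z = 0)
    (hx : f x + φ x / (2 * a) ≤ f y + φ y / (2 * a))
    (hy : f y + φ y / (2 * b) ≤ f z + φ z / (2 * b)) :
    φ y ≤ (f z - (f x + φ x / (2 * a))) * (2 * a * b) / (a - b) := by
  have ha : 0 < a := hb.trans hba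
  have h : φ y / (2 * b) - φ y / (2 * a) ≤ f z - (f x + φ x / (2 * a)) := by
    rw [hz, zero_div] at hy
    linarith
  rw [le_div_iff₀ (sub_pos.2 hba)]
  calc φ y * (a - b) = (φ y / (2 * b) - φ y / (2 * a)) * (2 * a * b) := by
        field_simp
    _ ≤ _ := by gcongr

/-- Vanishing infeasibility in the sequential penalty method: if `f` is bounded
below on the (nonempty) feasible region `X = {x : φ x = 0}`, then the
constraint violations of the penalty minimizers tend to zero. -/
theorem penalty_violation_tendsto_zero {n : ℕ}
    (f φ : EuclideanSpace ℝ (Fin n) → ℝ)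
    (hφ : ∀ x, 0 ≤ φ x)
    (hX : Set.Nonempty {x : EuclideanSpace ℝ (Fin n) | φ x = 0})
    (hbdd : ∃ L : ℝ, ∀ x, φ x = 0 → L ≤ f x)
    (P : EuclideanSpace ℝ (Fin n) → ℝ → ℝ)
    (hP : ∀ x ε, P x ε = f x + φ x / (2 * ε))
    (ε : ℕ → ℝ) (hεpos : ∀ k, 0 < ε k) (hεanti : StrictAnti ε)
    (hεlim : Tendsto ε atTop (nhds 0))
    (xk : ℕ → EuclideanSpace ℝ (Fin n))
    (hmin : ∀ k, ∀ x, P (xk k) (ε k) ≤ P x (ε k)) :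
    Tendsto (fun k => φ (xk k)) atTop (nhds 0) := by
  obtain ⟨z, hz⟩ := hX
  simp only [hP] at hmin
  have hlim : Tendsto (fun k => (f z - (f (xk 0) + φ (xk 0) / (2 * ε 0))) * (2 * ε 0 * ε k) /
      (ε 0 - ε k)) atTop (nhds 0) := by
    have hne : ε 0 - 0 ≠ 0 := by simpa using (hεpos 0).ne'
    simpa [Pi.div_def] using ((hεlim.const_mul (2 * ε 0)).const_mul
      (f z - (f (xk 0) + φ (xk 0) / (2 * ε 0)))).div (hεlim.const_sub (ε 0)) hne
  refine squeeze_zero' (Eventually.of_forall fun k => hφ (xk k)) ?_ hlim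
  filter_upwards [eventually_gt_atTop 0] with k hk
  exact violation_le_of_penalty_minimizers (hεpos k) (hεanti hk) hz (hmin 0 (xk k)) (hmin k z)
end

section
/- Let f : ℝⁿ → ℝ and φ : ℝⁿ → ℝ be continuous functions with φ(x) ≥ 0 for all x, let X = {x ∈ ℝⁿ : φ(x) = 0} be nonempty, and assume f is bounded below on X. Let P(x, ε) = f(x) + φ(x)/(2ε), let (ε_k) be a strictly decreasing sequence of positive real numbers converging to 0, and for each k let x^k be a global minimizer of P(·, ε_k) over ℝⁿ. Then every limit point x* of the sequence (x^k) (i.e. limit of a convergent subsequence) satisfies φ(x*) = 0 and f(x*) ≤ f(x) for all x ∈ X; that is, x* is a global minimizer of f over the feasible region X. -/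
open Filter

/-- Final claim of the sequential penalty method convergence theorem: every
limit point of the sequence of penalty minimizers is feasible and is a global
minimizer of `f` over the feasible region `X = {x : φ x = 0}`. -/
theorem penalty_limit_point_solves {n : ℕ}
    (f φ : EuclideanSpace ℝ (Fin n) → ℝ)
    (hf : Continuous f) (hφc : Continuous φ)
    (hφ : ∀ x, 0 ≤ φ x)
    (hX : Set.Nonempty {x : EuclideanSpace ℝ (Fin n) | φ x = 0})
    (hbdd : ∃ L : ℝ, ∀ x, φ x = 0 → L ≤ f x)
    (P : EuclideanSpace ℝ (Fin n) → ℝ → ℝ)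
    (hP : ∀ x ε, P x ε = f x + φ x / (2 * ε))
    (ε : ℕ → ℝ) (hεpos : ∀ k, 0 < ε k) (hεanti : StrictAnti ε)
    (hεlim : Tendsto ε atTop (nhds 0))
    (xk : ℕ → EuclideanSpace ℝ (Fin n))
    (hmin : ∀ k, ∀ x, P (xk k) (ε k) ≤ P x (ε k))
    (xstar : EuclideanSpace ℝ (Fin n))
    (hlimpt : ∃ ψ : ℕ → ℕ, StrictMono ψ ∧
      Tendsto (fun k => xk (ψ k)) atTop (nhds xstar)) :
    φ xstar = 0 ∧ ∀ x, φ x = 0 → f xstar ≤ f x := by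
  obtain ⟨ψ, hψ, hlim⟩ := hlimpt
  have hfl : Tendsto (fun k => f (xk (ψ k))) atTop (nhds (f xstar)) :=
    (hf.tendsto xstar).comp hlim
  have hφl : Tendsto (fun k => φ (xk (ψ k))) atTop (nhds (φ xstar)) :=
    (hφc.tendsto xstar).comp hlim
  have hεl : Tendsto (fun k => ε (ψ k)) atTop (nhds 0) := hεlim.comp hψ.tendsto_atTop
  have hle : ∀ x, φ x = 0 → ∀ k, f (xk k) + φ (xk k) / (2 * ε k) ≤ f x := by
    intro x hx k
    simpa [hP, hx] using hmin k x
  refine ⟨le_antisymm ?_ (hφ xstar), fun x hx => ?_⟩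
  · obtain ⟨x, hx⟩ := hX
    have hbound : Tendsto (fun k => (f x - f (xk (ψ k))) * (2 * ε (ψ k))) atTop (nhds 0) := by
      simpa using (hfl.const_sub (f x)).mul (hεl.const_mul 2)
    refine le_of_tendsto_of_tendsto' hφl hbound fun k => ?_
    have hpos : 0 < 2 * ε (ψ k) := mul_pos two_pos (hεpos _)
    rw [← div_le_iff₀ hpos]
    linarith [hle x hx (ψ k)]
  · refine le_of_tendsto' hfl fun k => ?_
    have hpen : 0 ≤ φ (xk (ψ k)) / (2 * ε (ψ k)) :=
      div_nonneg (hφ _) (mul_pos two_pos (hεpos _)).le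
    linarith [hle x hx (ψ k)]
end

section
/- Let A ∈ ℝ^{m×n}, b ∈ ℝᵐ, c ∈ ℝⁿ, and let B = {j_1, …, j_m} ⊆ {1, …, n} be such that A_{·B} is invertible, with N = {1, …, n} \ B, and assume x̄_B = A_{·B}⁻¹ b ≥ 0 and x̄_N = 0. Let j_r ∈ N have reduced cost c̄_{j_r} = c_{j_r} − ⟨A_{·j_r}, A_{·B}^{-T} c_B⟩ < 0, let Ā = A_{·B}⁻¹ A_{·j_r}, assume Ā_i > 0 for at least one i, and set ρ̄ = min{ (x̄_B)_i / Ā_i : i with Ā_i > 0 }. Define x̂ ∈ ℝⁿ by x̂_{j_r} = ρ̄, x̂_B = x̄_B − ρ̄ Ā, and x̂_j = 0 for all other indices j. Then A x̂ = b, x̂ ≥ 0, and ⟨c, x̂⟩ = ⟨c, x̄⟩ + ρ̄ c̄_{j_r}; in particular, if ρ̄ > 0 (a non-degenerate step) then ⟨c, x̂⟩ < ⟨c, x̄⟩. -/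
open Matrix

theorem Fintype.sum_eq_sum_embedding_add {ι κ M : Type*} [Fintype ι] [Fintype κ]
    [AddCommMonoid M] (e : κ ↪ ι) {a : ι} (ha : a ∉ Set.range e) (g : ι → M)
    (hg : ∀ j, j ∉ Set.range e → j ≠ a → g j = 0) :
    ∑ j, g j = ∑ k, g (e k) + g a := by
  classical
  have ha' : a ∉ Finset.univ.map e := by simpa using ha
  rw [← Finset.sum_map Finset.univ e g, add_comm, ← Finset.sum_insert ha']
  refine (Finset.sum_subset (Finset.subset_univ _) fun j _ hj => ?_).symm
  rw [Finset.mem_insert, not_or] at hj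
  exact hg j (by simpa using hj.2) hj.1

theorem Matrix.dotProduct_transpose_inv_mulVec {m R : Type*} [Fintype m] [DecidableEq m]
    [CommRing R] (M : Matrix m m R) (v w : m → R) :
    v ⬝ᵥ (Mᵀ⁻¹ *ᵥ w) = w ⬝ᵥ (M⁻¹ *ᵥ v) := by
  rw [← transpose_nonsing_inv, mulVec_transpose, dotProduct_comm, dotProduct_mulVec]

/-- Pivot step of the simplex method: the point `x̂` produced by the ratio test
and pivot step is feasible and its objective value is
`⟨c,x̄⟩ + ρ̄·c̄_{j_r}`; in particular a non-degenerate step (`ρ̄ > 0`)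
strictly decreases the objective. -/
theorem simplex_pivot_step {m n : ℕ}
    (A : Matrix (Fin m) (Fin n) ℝ) (b : Fin m → ℝ) (c : Fin n → ℝ)
    (β : Fin m ↪ Fin n)
    (hM : IsUnit (A.submatrix id ⇑β).det)
    (xbar : Fin n → ℝ)
    (hxbarB : ∀ k, xbar (β k) = ((A.submatrix id ⇑β)⁻¹ *ᵥ b) k)
    (hxbarN : ∀ j, j ∉ Set.range β → xbar j = 0)
    (hfeasB : ∀ k, 0 ≤ ((A.submatrix id ⇑β)⁻¹ *ᵥ b) k)
    (jr : Fin n) (hjr : jr ∉ Set.range β)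
    (cbar : ℝ)
    (hcbar : cbar = c jr - ∑ i, A i jr *
      (((A.submatrix id ⇑β)ᵀ)⁻¹ *ᵥ fun k => c (β k)) i)
    (hcbarneg : cbar < 0)
    (Abar : Fin m → ℝ)
    (hAbar : Abar = (A.submatrix id ⇑β)⁻¹ *ᵥ fun i => A i jr)
    (hpos : ∃ i, 0 < Abar i)
    (ρ : ℝ)
    (hρ : IsLeast
      {r : ℝ | ∃ i, 0 < Abar i ∧ r = ((A.submatrix id ⇑β)⁻¹ *ᵥ b) i / Abar i} ρ)
    (xhat : Fin n → ℝ)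
    (hxhatr : xhat jr = ρ)
    (hxhatB : ∀ k, xhat (β k) = ((A.submatrix id ⇑β)⁻¹ *ᵥ b) k - ρ * Abar k)
    (hxhat0 : ∀ j, j ∉ Set.range β → j ≠ jr → xhat j = 0) :
    A *ᵥ xhat = b ∧ (∀ j, 0 ≤ xhat j) ∧
    (∑ j, c j * xhat j = ∑ j, c j * xbar j + ρ * cbar) ∧
    (0 < ρ → ∑ j, c j * xhat j < ∑ j, c j * xbar j) := by
  have hsolve (v : Fin m → ℝ) (i : Fin m) :
      ∑ k, A i (β k) * ((A.submatrix id ⇑β)⁻¹ *ᵥ v) k = v i := by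
    have h : A.submatrix id ⇑β *ᵥ ((A.submatrix id ⇑β)⁻¹ *ᵥ v) = v := by
      rw [mulVec_mulVec, mul_nonsing_inv _ hM, one_mulVec]
    exact congrFun h i
  have hsum_hat (f : Fin n → ℝ) : ∑ j, f j * xhat j =
      ∑ k, f (β k) * ((A.submatrix id ⇑β)⁻¹ *ᵥ b) k
        - ρ * ∑ k, f (β k) * Abar k + f jr * ρ := by
    rw [Fintype.sum_eq_sum_embedding_add β hjr (fun j => f j * xhat j)
      fun j hj hne => by simp [hxhat0 j hj hne], hxhatr, Finset.mul_sum,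
      ← Finset.sum_sub_distrib]
    congr 1
    refine Finset.sum_congr rfl fun k _ => ?_
    rw [hxhatB]
    ring
  have hsum_bar : ∑ j, c j * xbar j =
      ∑ k, c (β k) * ((A.submatrix id ⇑β)⁻¹ *ᵥ b) k := by
    rw [Fintype.sum_eq_sum_embedding_add β hjr (fun j => c j * xbar j)
      fun j hj _ => by simp [hxbarN j hj]]
    simp [hxbarN jr hjr, hxbarB]
  have hcbar' : cbar = c jr - ∑ k, c (β k) * Abar k := by
    rw [hcbar, hAbar]
    exact congrArg (c jr - ·) (dotProduct_transpose_inv_mulVec _ _ _)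
  have hρ0 : 0 ≤ ρ := by
    obtain ⟨i, hi, rfl⟩ := hρ.1
    exact div_nonneg (hfeasB i) hi.le
  have hobj : ∑ j, c j * xhat j = ∑ j, c j * xbar j + ρ * cbar := by
    rw [hsum_hat, hsum_bar, hcbar']
    ring
  refine ⟨?_, fun j => ?_, hobj, fun h => ?_⟩
  · ext i
    change ∑ j, A i j * xhat j = b i
    rw [hsum_hat (A i), hAbar, hsolve, hsolve]
    ring
  · by_cases hj : j ∈ Set.range β
    · obtain ⟨k, rfl⟩ := hj
      rw [hxhatB, sub_nonneg]
      rcases lt_or_ge 0 (Abar k) with hk | hk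
      · exact (le_div_iff₀ hk).1 (hρ.2 ⟨k, hk, rfl⟩)
      · exact (mul_nonpos_of_nonneg_of_nonpos hρ0 hk).trans (hfeasB k)
    · rcases eq_or_ne j jr with rfl | hne
      · rwa [hxhatr]
      · rw [hxhat0 j hj hne]
  · rw [hobj]
    linarith [mul_neg_of_pos_of_neg h hcbarneg]
end

section
/- Let I be a nonempty finite index set and for each i ∈ I let w_i ∈ ℝ^{m+1} (indexed by k = 0, 1, …, m), with the vectors w_i pairwise distinct. Let i* ∈ I be the unique index at which the lexicographic minimum of {w_i : i ∈ I} is attained. Then there exists ε̄ > 0 such that for every ε ∈ (0, ε̄) and every i ∈ I with i ≠ i*: ∑_{k=0}^{m} w_{i*,k} ε^k < ∑_{k=0}^{m} w_{i,k} ε^k; i.e. for all sufficiently small ε > 0 the index minimizing the perturbed value ∑_k w_{i,k} ε^k is exactly the lexicographically minimal index i*. -/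
/-- `lexLt u v`: `u` strictly precedes `v` in the lexicographic order, i.e.
at the first coordinate where they differ, the coordinate of `u` is smaller. -/
def lexLt {m : ℕ} (u v : Fin m → ℝ) : Prop :=
  ∃ k, (∀ l < k, u l = v l) ∧ u k < v k

open Filter Topology in
/-- A lexicographically smaller coefficient vector has the smaller power sum at every
sufficiently small positive argument. -/
theorem lexLt.eventually_sum_mul_pow_lt {m : ℕ} {u v : Fin m → ℝ} (h : lexLt u v) :
    ∀ᶠ ε in 𝓝[>] (0 : ℝ), ∑ j, u j * ε ^ (j : ℕ) < ∑ j, v j * ε ^ (j : ℕ) := by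
  obtain ⟨k, hlt, hk⟩ := h
  have hcont : Continuous fun ε : ℝ => ∑ j, (v j - u j) * ε ^ ((j : ℕ) - k) := by fun_prop
  have hzero : ∑ j, (v j - u j) * (0 : ℝ) ^ ((j : ℕ) - k) = v k - u k := by
    rw [Finset.sum_eq_single k]
    · simp
    · intro j _ hj
      rcases lt_or_gt_of_ne hj with hjk | hjk
      · simp [hlt j hjk]
      · rw [zero_pow (Nat.sub_pos_of_lt hjk).ne', mul_zero]
    · simp
  have hpos : ∀ᶠ ε in 𝓝 (0 : ℝ), 0 < ∑ j, (v j - u j) * ε ^ ((j : ℕ) - k) :=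
    hcont.continuousAt.eventually_const_lt ((sub_pos.mpr hk).trans_eq hzero.symm)
  filter_upwards [hpos.filter_mono nhdsWithin_le_nhds, self_mem_nhdsWithin] with ε hε hε0
  rw [← sub_pos, ← Finset.sum_sub_distrib]
  refine (mul_pos (pow_pos hε0 (k : ℕ)) hε).trans_eq ?_
  rw [Finset.mul_sum]
  refine Finset.sum_congr rfl fun j _ => ?_
  rcases lt_or_ge j k with hjk | hjk
  · simp [hlt j hjk]
  · rw [mul_left_comm, ← pow_add, Nat.add_sub_cancel' hjk, sub_mul]

/-- For pairwise distinct vectors `w_i ∈ ℝ^{m+1}`, the index minimizing the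
perturbed value `∑_k w_{i,k} ε^k` for all sufficiently small `ε > 0` is exactly
the index at which the lexicographic minimum is attained: the leaving row
selected by the grossone/ε-perturbed ratio test is the row chosen by the
lexicographic pivoting rule. -/
theorem lex_min_eq_perturbed_min {ι : Type*} {m : ℕ}
    (I : Finset ι) (hI : I.Nonempty)
    (w : ι → Fin (m + 1) → ℝ)
    (hdist : ∀ i ∈ I, ∀ j ∈ I, i ≠ j → w i ≠ w j)
    (istar : ι) (histar : istar ∈ I)
    (hmin : ∀ i ∈ I, i ≠ istar → lexLt (w istar) (w i)) :
    ∃ εbar > 0, ∀ ε ∈ Set.Ioo (0 : ℝ) εbar, ∀ i ∈ I, i ≠ istar →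
      ∑ k, w istar k * ε ^ (k : ℕ) < ∑ k, w i k * ε ^ (k : ℕ) := by
  have hev : ∀ᶠ ε in nhdsWithin (0 : ℝ) (Set.Ioi 0), ∀ i ∈ I, i ≠ istar →
      ∑ k, w istar k * ε ^ (k : ℕ) < ∑ k, w i k * ε ^ (k : ℕ) := by
    refine (Filter.eventually_all_finset I).mpr fun i hi => ?_
    exact Filter.eventually_imp_distrib_left.mpr fun hne =>
      (hmin i hi hne).eventually_sum_mul_pow_lt
  obtain ⟨εbar, hεbar, hsub⟩ := mem_nhdsGT_iff_exists_Ioo_subset.mp hev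
  exact ⟨εbar, hεbar, fun ε hε => hsub hε⟩
end

section
/- Let A ∈ ℝ^{m×n}, b ∈ ℝᵐ, and let B₀ ⊆ {1, …, n} with |B₀| = m be such that A_{·B₀} is invertible. For ε > 0 define the perturbed right-hand side b(ε) = b + A_{·B₀} e(ε), where e(ε) = (ε, ε², …, εᵐ)ᵀ. Then there exists ε̄ > 0 such that for every ε ∈ (0, ε̄) and every B ⊆ {1, …, n} with |B| = m and A_{·B} invertible, all m components of A_{·B}⁻¹ b(ε) are nonzero; that is, for all sufficiently small ε > 0 every basic solution of the perturbed linear program Ax = b(ε), x ≥ 0 is non-degenerate. -/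
open Matrix

open Polynomial in
/-- A real polynomial with a nonzero non-constant coefficient has only finitely many roots. -/
theorem eventually_cofinite_add_sum_mul_pow_succ_ne_zero {m : ℕ} (a : ℝ) {c : Fin m → ℝ}
    (hc : c ≠ 0) : ∀ᶠ ε in Filter.cofinite, a + ∑ k, c k * ε ^ ((k : ℕ) + 1) ≠ 0 := by
  obtain ⟨j, hj⟩ := Function.ne_iff.mp hc
  let P : ℝ[X] := C a + ∑ k : Fin m, C (c k) * X ^ ((k : ℕ) + 1)
  have hP : P ≠ 0 := by
    intro h
    have hcoeff : P.coeff ((j : ℕ) + 1) = c j := by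
      simp [P, coeff_X_pow, Fin.val_inj]
    exact hj (by rw [← hcoeff, h, coeff_zero, Pi.zero_apply])
  refine (finite_setOfPred_isRoot hP).subset fun ε hε => ?_
  simpa [P, IsRoot, eval_finsetSum] using hε

/-- No row of the product of the inverse of an invertible matrix with an invertible matrix
vanishes. -/
theorem inv_mul_row_ne_zero {m : ℕ} {M N : Matrix (Fin m) (Fin m) ℝ}
    (hM : IsUnit M.det) (hN : IsUnit N.det) (i : Fin m) : (M⁻¹ * N) i ≠ 0 := by
  intro h
  have hdet : IsUnit (M⁻¹ * N).det := by
    rw [det_mul]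
    exact (isUnit_nonsing_inv_det M hM).mul hN
  exact hdet.ne_zero (det_eq_zero_of_row_eq_zero i (congrFun h))

/-- The classical perturbation justification of the lexicographic (anti-cycling)
simplex rule: perturbing the right-hand side by `b(ε) = b + A_{·B₀}(ε,…,εᵐ)ᵀ`
makes, for all sufficiently small `ε > 0`, every basic solution of the
perturbed linear program non-degenerate (all basic components nonzero). -/
theorem perturbed_rhs_nondegenerate {m n : ℕ}
    (A : Matrix (Fin m) (Fin n) ℝ) (b : Fin m → ℝ)
    (β0 : Fin m ↪ Fin n)
    (h0 : IsUnit (A.submatrix id ⇑β0).det) :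
    ∃ εbar > 0, ∀ ε ∈ Set.Ioo (0 : ℝ) εbar,
      ∀ β : Fin m ↪ Fin n, IsUnit (A.submatrix id ⇑β).det →
        ∀ i, ((A.submatrix id ⇑β)⁻¹ *ᵥ
          (b + (A.submatrix id ⇑β0) *ᵥ fun k => ε ^ ((k : ℕ) + 1))) i ≠ 0 := by
  have hcof : ∀ᶠ ε : ℝ in Filter.cofinite,
      ∀ β : Fin m ↪ Fin n, IsUnit (A.submatrix id ⇑β).det →
        ∀ i, ((A.submatrix id ⇑β)⁻¹ *ᵥ
          (b + (A.submatrix id ⇑β0) *ᵥ fun k => ε ^ ((k : ℕ) + 1))) i ≠ 0 := by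
    simp only [Filter.eventually_all]
    intro β hβ i
    filter_upwards [eventually_cofinite_add_sum_mul_pow_succ_ne_zero
      (((A.submatrix id ⇑β)⁻¹ *ᵥ b) i) (inv_mul_row_ne_zero hβ h0 i)] with ε hε
    rw [mulVec_add, mulVec_mulVec]
    exact hε
  have hright := (nhdsGT_le_nhdsNE (0 : ℝ)).trans (nhdsNE_le_cofinite 0) hcof
  obtain ⟨εbar, hpos, hsub⟩ := mem_nhdsGT_iff_exists_Ioo_subset.mp hright
  exact ⟨εbar, hpos, hsub⟩
end
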